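/- arXiv:2602.10769 — 4 statements merged into one kernel-verified Lean document; each statement's English description precedes it below -/
import Mathlib

section
/- For g = (a,b;c,d) ∈ Γ_θ, set β̄(g) := G(d,c)·e^{(iπ/4)·sgn c} if c ≠ 0 and β̄(g) := e^{−(iπ/4)(1−sgn d)} if c = 0, and set β̂(g) := β̄(g)·s̄(g)⁻¹ (which equals 1 whenever c = 0 or d = 0). Then for all g₁, g₂ ∈ Γ_θ: (i) c̄(g₁,g₂) = β̄(g₁)⁻¹ · β̄(g₂)⁻¹ · β̄(g₁g₂); and (ii) ĉ_{z₀}(g₁,g₂) = β̂(g₁)⁻¹ · β̂(g₂)⁻¹ · β̂(g₁g₂). -/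
noncomputable section

/-- The real Hilbert symbol `(a,b)_ℝ`. -/
def hilb (a b : ℝ) : ℝ := if a < 0 ∧ b < 0 then -1 else 1

def xEnt (g : Matrix (Fin 2) (Fin 2) ℝ) : ℝ := if g 1 0 = 0 then g 1 1 else g 1 0

/-- Rao's sign cocycle `c̄` on `SL₂(ℝ)`. -/
def raoC (g₁ g₂ : Matrix (Fin 2) (Fin 2) ℝ) : ℝ :=
  hilb (xEnt g₁) (xEnt g₂) * hilb (-(xEnt g₁ * xEnt g₂)) (xEnt (g₁ * g₂))

/-- The argument of a nonzero complex number, normalized to lie in `[-π, π)`. -/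
def myArg (z : ℂ) : ℝ := if Complex.arg z = Real.pi then -Real.pi else Complex.arg z

/-- `s̄(g) := e^{i · Arg(ci+d)/2}`. -/
def sbar (g : Matrix (Fin 2) (Fin 2) ℝ) : ℂ :=
  Complex.exp (Complex.I * (myArg ((g 1 0 : ℂ) * Complex.I + (g 1 1 : ℂ))) / 2)

/-- The Möbius action of a `2 × 2` real matrix on `ℂ`. -/
def mobius (g : Matrix (Fin 2) (Fin 2) ℝ) (z : ℂ) : ℂ :=
  ((g 0 0 : ℂ) * z + (g 0 1 : ℂ)) / ((g 1 0 : ℂ) * z + (g 1 1 : ℂ))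

/-- `γ(z', z)` with the principal branch of the inverse square root. -/
def gammaK (z' z : ℂ) : ℂ :=
  ((z' - (starRingEnd ℂ) z) / (2 * Complex.I)) ^ (-(1 / 2) : ℂ) *
    ((z'.im ^ ((1 : ℝ) / 4) : ℝ) : ℂ) * ((z.im ^ ((1 : ℝ) / 4) : ℝ) : ℂ)

/-- The cocycle `ĉ_{z₀}` with `z₀ = i`. -/
def chat (g₁ g₂ : Matrix (Fin 2) (Fin 2) ℝ) : ℂ :=
  gammaK (mobius g₁ Complex.I) (mobius (g₁ * g₂) Complex.I) /
    gammaK Complex.I (mobius g₂ Complex.I)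

/-- The symplectic Gauss sum `G(d, c)`. -/
def gaussG (d c : ℤ) : ℂ :=
  (((c.natAbs : ℝ) ^ (-(1 : ℝ) / 2) : ℝ) : ℂ) *
    ∑ n ∈ Finset.range c.natAbs,
      Complex.exp (-(Real.pi : ℂ) * Complex.I * (d : ℂ) * (n : ℂ) ^ 2 / (c : ℂ))

def toR (g : Matrix (Fin 2) (Fin 2) ℤ) : Matrix (Fin 2) (Fin 2) ℝ := g.map fun x => (x : ℝ)

/-- `β̄(g)` on `Γ_θ`. -/
def betaBar (g : Matrix (Fin 2) (Fin 2) ℤ) : ℂ :=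
  if g 1 0 = 0 then
    Complex.exp (-(Complex.I * (Real.pi : ℂ) / 4) * ((1 : ℂ) - (Int.sign (g 1 1) : ℂ)))
  else gaussG (g 1 1) (g 1 0) *
    Complex.exp (Complex.I * (Real.pi : ℂ) / 4 * (Int.sign (g 1 0) : ℂ))

/-- `β̂(g) := β̄(g) · s̄(g)⁻¹`. -/
def betaHat (g : Matrix (Fin 2) (Fin 2) ℤ) : ℂ := betaBar g * (sbar (toR g))⁻¹

open Complex Filter Topology in
lemma theta_tendsto (x : ℝ) (τ : ℝ → ℂ) (h : Tendsto (fun s => (τ s).im) atTop atTop) :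
    Tendsto (fun s => jacobiTheta₂ (x : ℂ) (τ s)) atTop (𝓝 1) := by
  have h1 : (1 : ℂ) = ∑' n : ℤ, if n = 0 then (1 : ℂ) else 0 := by
    rw [tsum_ite_eq]
  rw [h1]
  unfold jacobiTheta₂
  have hb : Summable (fun n : ℤ => ‖jacobiTheta₂_term n 0 Complex.I‖) :=
    ((summable_jacobiTheta₂_term_iff 0 Complex.I).2 (by simp)).norm
  refine tendsto_tsum_of_dominated_convergence hb ?_ ?_
  · intro n
    by_cases hn : n = 0
    · subst hn; simp [jacobiTheta₂_term]
    · rw [if_neg hn, tendsto_zero_iff_norm_tendsto_zero]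
      simp only [norm_jacobiTheta₂_term]
      refine Real.tendsto_exp_atBot.comp ?_
      simp only [ofReal_im, mul_zero, sub_zero]
      refine h.const_mul_atTop_of_neg ?_
      have : (0:ℝ) < (n:ℝ)^2 := by positivity
      nlinarith [Real.pi_pos]
  · filter_upwards [h.eventually_ge_atTop 1] with s hs n
    simp only [norm_jacobiTheta₂_term]
    refine Real.exp_le_exp.2 ?_
    simp only [ofReal_im, mul_zero, sub_zero, zero_im, I_im, mul_one]
    have : (0:ℝ) ≤ (n:ℝ)^2 := by positivity
    nlinarith [mul_nonneg Real.pi_pos.le this]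

/-- unnormalised Gauss sum -/
def gS (p : ℤ) (q : ℕ) : ℂ :=
  ∑ r ∈ Finset.range q, Complex.exp (Real.pi * Complex.I * p * (r : ℂ) ^ 2 / q)

open Complex in
lemma exp_even_aux (k : ℤ) (hk : Even k) : cexp (Real.pi * I * k) = 1 := by
  obtain ⟨m, rfl⟩ := hk
  rw [Complex.exp_eq_one_iff]
  exact ⟨m, by push_cast; ring⟩

open Complex in
lemma real_mul_cpow_aux (a : ℝ) (ha : 0 < a) (w : ℂ) (hw : w ≠ 0) (r : ℂ) :
    ((a : ℂ) * w) ^ r = (a : ℂ) ^ r * w ^ r := by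
  have ha' : (a : ℂ) ≠ 0 := by exact_mod_cast ha.ne'
  rw [cpow_def_of_ne_zero (mul_ne_zero ha' hw), cpow_def_of_ne_zero ha', cpow_def_of_ne_zero hw,
    log_ofReal_mul ha hw, ← Complex.exp_add, ofReal_log ha.le]
  ring_nf

open Complex in
lemma theta_split (p : ℤ) (q : ℕ) (hq : 0 < q) (hpq : Even (p * q)) (w : ℂ) (hw : 0 < w.re) :
    jacobiTheta₂ 0 (p / q + I / w) = w ^ (1 / 2 : ℂ) / q *
      ∑ r ∈ Finset.range q, cexp (Real.pi * I * p * (r : ℂ) ^ 2 / q) *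
        jacobiTheta₂ ((r / q : ℝ) : ℂ) (I * w / q ^ 2) := by
  have hw0 : w ≠ 0 := by rintro rfl; simp at hw
  have hq0 : (q : ℂ) ≠ 0 := by exact_mod_cast hq.ne'
  have hN : 0 < normSq w := normSq_pos.2 hw0
  have him : 0 < ((p : ℂ) / q + I / w).im := by
    have : ((p : ℂ) / q).im = 0 := by
      have : ((p : ℂ) / q) = ((p / q : ℝ) : ℂ) := by push_cast; rfl
      rw [this, ofReal_im]
    rw [add_im, this, div_im]; simp; positivity
  have hsum := (summable_jacobiTheta₂_term_iff 0 _).2 him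
  have : NeZero q := ⟨hq.ne'⟩
  let e := (Int.divModEquiv q).trans (Equiv.prodComm ℤ (Fin q))
  have hsum2 : Summable (fun x : Fin q × ℤ => jacobiTheta₂_term (e.symm x) 0 (p / q + I / w)) :=
    (e.symm.summable_iff (f := fun n => jacobiTheta₂_term n 0 (p / q + I / w))).2 hsum
  have h1 : jacobiTheta₂ 0 (p / q + I / w) =
      ∑ r : Fin q, ∑' m : ℤ, jacobiTheta₂_term (m * q + (r : ℕ)) 0 (p / q + I / w) := by
    unfold jacobiTheta₂
    rw [← e.symm.tsum_eq, hsum2.tsum_prod, tsum_fintype]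
    rfl
  rw [h1, Finset.sum_range, Finset.mul_sum]
  refine Finset.sum_congr rfl fun r _ => ?_
  have hterm : ∀ m : ℤ, jacobiTheta₂_term (m * q + (r : ℕ)) 0 (p / q + I / w) =
      cexp (Real.pi * I * p * ((r : ℕ) : ℂ) ^ 2 / q) * cexp (-Real.pi * (r:ℕ)^2 / w) *
        jacobiTheta₂_term m (I * q * (r:ℕ) / w) (I * q ^ 2 / w) := by
    intro m
    unfold jacobiTheta₂_term
    have he : Even (p * q * m ^ 2 + 2 * (p * m * (r:ℕ))) := by
      exact (hpq.mul_right _).add (even_two_mul _)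
    rw [← one_mul (cexp (Real.pi * I * p * ((r : ℕ) : ℂ) ^ 2 / q)), ← exp_even_aux _ he,
      ← Complex.exp_add, ← Complex.exp_add, ← Complex.exp_add]
    congr 1
    push_cast
    have hI : I ^ 2 = -1 := I_sq
    field_simp
    ring_nf
    simp only [hI]
    ring
  simp_rw [hterm]
  rw [tsum_mul_left]
  change _ * jacobiTheta₂ _ _ = _
  rw [jacobiTheta₂_functional_equation]
  have e1 : -I * (I * (q:ℂ) ^ 2 / w) = ((q ^ 2 : ℝ) : ℂ) * w⁻¹ := by
    push_cast
    rw [show -I * (I * (q:ℂ) ^ 2 / w) = -(I * I) * q ^ 2 * w⁻¹ by ring, I_mul_I]; ring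
  have harg : w.arg ≠ Real.pi := by
    intro h; rw [arg_eq_pi_iff] at h; linarith [h.1]
  have e2 : (((q ^ 2 : ℝ) : ℂ) * w⁻¹) ^ (1 / 2 : ℂ) = q * (w ^ (1 / 2 : ℂ))⁻¹ := by
    rw [real_mul_cpow_aux _ (by positivity) _ (inv_ne_zero hw0), inv_cpow _ _ harg]
    congr 1
    rw [show (1 / 2 : ℂ) = ((1 / 2 : ℝ) : ℂ) by push_cast; rfl, ← ofReal_cpow (by positivity),
      ← Real.sqrt_eq_rpow, Real.sqrt_sq (by positivity)]
    simp
  rw [e1, e2]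
  have e3 : I * (q:ℂ) * (r:ℕ) / w / (I * q ^ 2 / w) = (((r:ℕ) / q : ℝ) : ℂ) := by
    push_cast; field_simp [I_ne_zero]
  have e4 : -1 / (I * (q:ℂ) ^ 2 / w) = I * w / q ^ 2 := by
    have := I_ne_zero
    field_simp; rw [I_sq]
  have e5 : -(Real.pi:ℂ) * I * (I * (q:ℂ) * (r:ℕ) / w) ^ 2 / (I * q ^ 2 / w) = -(-Real.pi * (r:ℕ)^2 / w) := by
    have := I_ne_zero
    field_simp; ring_nf; rw [I_sq]; ring
  rw [e3, e4, e5, Complex.exp_neg]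
  have := Complex.exp_ne_zero (-Real.pi * (r:ℕ)^2 / w)
  have h9 : w ^ (1/2:ℂ) ≠ 0 := by simp [cpow_eq_zero_iff, hw0]
  field_simp

open Complex Filter Topology in
lemma landsberg_schaar (p q : ℕ) (hp : 0 < p) (hq : 0 < q) (hpq : Even (p * q)) :
    gS p q = 1 / (-I * (p / q)) ^ (1 / 2 : ℂ) * gS (-q) p := by
  have hp0 : (p : ℂ) ≠ 0 := by exact_mod_cast hp.ne'
  have hq0 : (q : ℂ) ≠ 0 := by exact_mod_cast hq.ne'
  have hpR : (0 : ℝ) < p := by exact_mod_cast hp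
  have hqR : (0 : ℝ) < q := by exact_mod_cast hq
  -- the two sums
  let A : ℝ → ℂ := fun s => ∑ r ∈ Finset.range q, cexp (Real.pi * I * (p : ℤ) * (r : ℂ) ^ 2 / q) *
        jacobiTheta₂ ((r / q : ℝ) : ℂ) (I * (s : ℂ) / q ^ 2)
  let u : ℝ → ℂ := fun s => (p / q : ℂ) ^ 2 + I * (p / q) * ((s⁻¹ : ℝ) : ℂ)
  let B : ℝ → ℂ := fun s =>
      ∑ r ∈ Finset.range p, cexp (Real.pi * I * (-q : ℤ) * (r : ℂ) ^ 2 / p) *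
        jacobiTheta₂ ((r / p : ℝ) : ℂ) (I * (s * u s) / p ^ 2)
  have hinv : Tendsto (fun s : ℝ => ((s⁻¹ : ℝ) : ℂ)) atTop (𝓝 0) := by
    have := (continuous_ofReal.tendsto 0).comp tendsto_inv_atTop_zero
    rw [ofReal_zero] at this
    exact this
  have hu : Tendsto u atTop (𝓝 ((p / q : ℂ) ^ 2)) := by
    have := (hinv.const_mul (I * (p / q : ℂ))).const_add ((p / q : ℂ) ^ 2)
    rw [mul_zero, add_zero] at this
    exact this
  have hre : ∀ s : ℝ, 0 < s → (s * u s : ℂ) = ((s * (p / q) ^ 2 : ℝ) : ℂ) + ((p / q : ℝ) : ℂ) * I := by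
    intro s hs
    have : (s : ℂ) ≠ 0 := by exact_mod_cast hs.ne'
    simp only [u]; push_cast; field_simp
  have hA : Tendsto A atTop (𝓝 (gS p q)) := by
    unfold gS
    refine tendsto_finsetSum _ fun r _ => ?_
    have := theta_tendsto (r / q : ℝ) (fun s => I * (s : ℂ) / q ^ 2) ?_
    · simpa using this.const_mul (cexp (Real.pi * I * (p : ℤ) * (r : ℂ) ^ 2 / q))
    · have : (fun s : ℝ => (I * (s : ℂ) / (q : ℂ) ^ 2).im) = fun s => s * ((q : ℝ) ^ 2)⁻¹ := by
        funext s
        have : I * (s : ℂ) / (q : ℂ) ^ 2 = ((s * ((q : ℝ) ^ 2)⁻¹ : ℝ) : ℂ) * I := by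
          push_cast; ring
        rw [this, im_ofReal_mul]; simp
      rw [this]
      exact tendsto_id.atTop_mul_const (by positivity)
  have hB : Tendsto B atTop (𝓝 (gS (-q) p)) := by
    unfold gS
    refine tendsto_finsetSum _ fun r _ => ?_
    have := theta_tendsto (r / p : ℝ) (fun s => I * (s * u s) / p ^ 2) ?_
    · have := this.const_mul (cexp (Real.pi * I * (-q : ℤ) * (r : ℂ) ^ 2 / p))
      rw [mul_one] at this
      exact this
    · have : (fun s : ℝ => s * ((q : ℝ) ^ 2)⁻¹) =ᶠ[atTop] (fun s : ℝ => (I * (s * u s) / (p : ℂ) ^ 2).im) := by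
        filter_upwards [eventually_gt_atTop 0] with s hs
        have : I * (s * u s) / (p : ℂ) ^ 2 =
            ((s * ((q : ℝ) ^ 2)⁻¹ : ℝ) : ℂ) * I + ((-(1 / (p * q)) : ℝ) : ℂ) := by
          rw [hre s hs]
          push_cast
          field_simp
          ring_nf
          rw [I_sq]; ring
        rw [this, add_im, ofReal_im, im_ofReal_mul]; simp
      refine Tendsto.congr' this ?_
      exact tendsto_id.atTop_mul_const (by positivity)
  have key : ∀ᶠ s in atTop, A s = 1 / (-I * (p / q + I * ((s⁻¹ : ℝ) : ℂ))) ^ (1 / 2 : ℂ) *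
      ((u s) ^ (1 / 2 : ℂ) * (q / p) * B s) := by
    filter_upwards [eventually_gt_atTop 0] with s hs
    have hs0 : (s : ℂ) ≠ 0 := by exact_mod_cast hs.ne'
    have hsu : (0:ℝ) < (s * u s : ℂ).re := by
      have : 0 < s * ((p : ℝ) / q) ^ 2 := by positivity
      rw [hre s hs, add_re, ofReal_re, re_ofReal_mul]; simpa using this
    have hu0 : u s ≠ 0 := by
      intro h; rw [h] at hsu; simp at hsu
    have t1 := theta_split p q hq (by exact_mod_cast hpq) (s : ℂ) (by simpa using hs)
    have t2 := theta_split (-q) p hp (by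
      rw [neg_mul, even_neg, mul_comm]; exact_mod_cast hpq) (s * u s : ℂ) hsu
    rw [jacobiTheta₂_functional_equation] at t1
    have hne : (p : ℂ) * s + I * q ≠ 0 := by
      intro h
      have := congrArg Complex.re h
      simp at this
      rcases this with h | h
      · omega
      · exact hs.ne' h
    have hne' : (p : ℂ) * s + q * I ≠ 0 := by rwa [mul_comm (q : ℂ)]
    have e1 : -1 / (((p : ℤ) : ℂ) / q + I / s) = ((-q : ℤ) : ℂ) / p + I / (s * u s) := by
      have hu1 : s * u s = p * (p * s + I * q) / q ^ 2 := by
        simp only [u]; push_cast; field_simp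
      rw [hu1]
      push_cast
      rw [show (p : ℂ) / q + I / s = (p * s + I * q) / (q * s) by field_simp]
      field_simp
      ring_nf
    rw [e1, zero_div, t2, real_mul_cpow_aux s hs (u s) hu0] at t1
    change _ * (_ * B s) = _ * A s at t1
    have h9 : (s : ℂ) ^ (1/2:ℂ) ≠ 0 := by simp [cpow_eq_zero_iff, hs0]
    have e2 : ((p : ℤ) : ℂ) / q + I / s = p / q + I * ((s⁻¹ : ℝ) : ℂ) := by
      push_cast; rfl
    rw [e2] at t1
    simp only [ne_eq, OfNat.ofNat_ne_zero, not_false_eq_true, zero_pow, mul_zero, zero_div,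
      Complex.exp_zero, mul_one] at t1
    have : A s = (s : ℂ) ^ (1/2:ℂ) / q * A s * (q / (s : ℂ) ^ (1/2:ℂ)) := by field_simp
    rw [this, ← t1]
    field_simp
  have hsl : (-I * (p / q : ℂ)) ∈ slitPlane := by
    rw [mem_slitPlane_iff]; right
    have : -I * (p / q : ℂ) = ((-(p / q) : ℝ) : ℂ) * I := by push_cast; ring
    rw [this, im_ofReal_mul]; simp; exact ⟨hp.ne', hq.ne'⟩
  have hsl2 : ((p / q : ℂ) ^ 2) ∈ slitPlane := by
    have : (p / q : ℂ) ^ 2 = (((p / q) ^ 2 : ℝ) : ℂ) := by push_cast; ring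
    rw [this, ofReal_mem_slitPlane]; positivity
  have l1 : Tendsto (fun s : ℝ => -I * (p / q + I * ((s⁻¹ : ℝ) : ℂ))) atTop (𝓝 (-I * (p / q : ℂ))) := by
    have := ((hinv.const_mul I).const_add (p / q : ℂ)).const_mul (-I)
    simpa using this
  have l2 := ((continuousAt_cpow_const (b := (1/2:ℂ)) hsl).tendsto.comp l1)
  have l3 := ((continuousAt_cpow_const (b := (1/2:ℂ)) hsl2).tendsto.comp hu)
  have hnz : (-I * (p / q : ℂ)) ^ (1/2:ℂ) ≠ 0 := by
    simp [cpow_eq_zero_iff, hp.ne', hq.ne']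
  have l4 := ((tendsto_const_nhds (x := (1:ℂ))).div l2 hnz).mul ((l3.mul_const (q / p : ℂ)).mul hB)
  have := tendsto_nhds_unique (hA.congr' key) l4
  rw [this]
  congr 1
  have e5 : ((p / q : ℂ) ^ 2) ^ (1/2:ℂ) = p / q := by
    have : (p / q : ℂ) ^ 2 = (((p / q) ^ 2 : ℝ) : ℂ) := by push_cast; ring
    rw [this, show (1 / 2 : ℂ) = ((1 / 2 : ℝ) : ℂ) by push_cast; rfl, ← ofReal_cpow (by positivity),
      ← Real.sqrt_eq_rpow, Real.sqrt_sq (by positivity)]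
    push_cast; rfl
  rw [e5]; field_simp

/-- normalised Gauss sum -/
def gN (p : ℤ) (q : ℕ) : ℂ := (((q : ℝ) ^ (-(1 : ℝ) / 2) : ℝ) : ℂ) * gS p q

open Complex in
lemma gN_recip (p q : ℕ) (hp : 0 < p) (hq : 0 < q) (hpq : Even (p * q)) :
    gN p q = cexp (I * Real.pi / 4) * gN (-q) p := by
  have hpR : (0 : ℝ) < p := by exact_mod_cast hp
  have hqR : (0 : ℝ) < q := by exact_mod_cast hq
  unfold gN
  rw [landsberg_schaar p q hp hq hpq]
  have e1 : -I * (p / q : ℂ) = ((p / q : ℝ) : ℂ) * (-I) := by push_cast; ring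
  have e2 : (-I) ^ (1/2:ℂ) = cexp (-(I * Real.pi / 4)) := by
    rw [cpow_def_of_ne_zero (neg_ne_zero.2 I_ne_zero), log_neg_I]
    congr 1; ring
  rw [e1, real_mul_cpow_aux _ (by positivity) _ (neg_ne_zero.2 I_ne_zero), e2, Complex.exp_neg,
    show (1 / 2 : ℂ) = ((1 / 2 : ℝ) : ℂ) by push_cast; rfl, ← ofReal_cpow (by positivity)]
  have e3 : (p / q : ℝ) ^ (1/2:ℝ) = (p:ℝ) ^ (1/2:ℝ) / (q:ℝ) ^ (1/2:ℝ) := Real.div_rpow hpR.le hqR.le _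
  have e4 : ∀ x : ℝ, 0 < x → x ^ (-(1:ℝ)/2) = (x ^ (1/2:ℝ))⁻¹ := by
    intro x hx; rw [← Real.rpow_neg hx.le]; congr 1; ring
  rw [e3, e4 _ hpR, e4 _ hqR]
  have h1 : ((q:ℝ) ^ (1/2:ℝ) : ℝ) ≠ 0 := by positivity
  have h2 : ((p:ℝ) ^ (1/2:ℝ) : ℝ) ≠ 0 := by positivity
  have h1' : (((q:ℝ) ^ (1/2:ℝ) : ℝ) : ℂ) ≠ 0 := by exact_mod_cast h1
  have h2' : (((p:ℝ) ^ (1/2:ℝ) : ℝ) : ℂ) ≠ 0 := by exact_mod_cast h2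
  have h3 := Complex.exp_ne_zero (I * Real.pi / 4)
  push_cast
  field_simp
def xC (u : ℂ) : ℝ := if u.im = 0 then u.re else u.im

def sqr (u : ℂ) : ℂ := Complex.exp (Complex.I * (myArg u) / 2)

lemma sqr_ne_zero' (u : ℂ) : sqr u ≠ 0 := Complex.exp_ne_zero _

lemma xC_ne_zero {u : ℂ} (hu : u ≠ 0) : xC u ≠ 0 := by
  unfold xC
  split_ifs with h
  · intro h2; exact hu (Complex.ext h2 h)
  · exact h

open Complex in
lemma myArg_pos {u : ℂ} (h : 0 < xC u) : 0 ≤ myArg u ∧ myArg u < Real.pi := by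
  have h1 : arg u ≠ Real.pi := by
    rw [Ne, arg_eq_pi_iff]
    rintro ⟨a, b⟩
    rw [xC, if_pos b] at h
    linarith
  have h2 : 0 ≤ u.im := by
    unfold xC at h; split_ifs at h with h0
    · exact h0.ge
    · exact h.le
  rw [myArg, if_neg h1]
  exact ⟨arg_nonneg_iff.2 h2, lt_of_le_of_ne (arg_le_pi u) h1⟩

open Complex in
lemma myArg_neg {u : ℂ} (h : xC u < 0) : -Real.pi ≤ myArg u ∧ myArg u < 0 := by
  by_cases h1 : arg u = Real.pi
  · rw [myArg, if_pos h1]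
    exact ⟨le_rfl, by linarith [Real.pi_pos]⟩
  · rw [myArg, if_neg h1]
    refine ⟨(neg_pi_lt_arg u).le, ?_⟩
    rw [arg_neg_iff]
    unfold xC at h; split_ifs at h with h0
    · exact absurd (arg_eq_pi_iff.2 ⟨h, h0⟩) h1
    · exact h

open Complex in
lemma exp_myArg (u : ℂ) : cexp (myArg u * I) = cexp (arg u * I) := by
  unfold myArg
  split_ifs with h
  · rw [h]; push_cast; rw [neg_mul, Complex.exp_neg, exp_pi_mul_I]; norm_num
  · rfl

open Complex in
lemma norm_mul_exp_myArg (u : ℂ) : (‖u‖ : ℂ) * cexp (myArg u * I) = u := by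
  rw [exp_myArg, norm_mul_exp_arg_mul_I]

open Complex in
lemma exp_myArg_eq {u : ℂ} (hu : u ≠ 0) : cexp (myArg u * I) = u / ‖u‖ := by
  have h : (‖u‖ : ℂ) ≠ 0 := by simpa using hu
  rw [eq_div_iff h, mul_comm, norm_mul_exp_myArg]

def eps (x y z : ℝ) : ℝ := hilb x y * hilb (-(x * y)) z

open Complex in
lemma sq_mul_sq {u v : ℂ} (hu : u ≠ 0) (hv : v ≠ 0) :
    (eps (xC u) (xC v) (xC (u * v)) : ℂ) * sqr (u * v) = sqr u * sqr v := by
  have huv := mul_ne_zero hu hv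
  have hk : ∃ k : ℤ, myArg u + myArg v = myArg (u * v) + 2 * Real.pi * k := by
    have : cexp ((myArg u + myArg v) * I) = cexp (myArg (u * v) * I) := by
      rw [add_mul, Complex.exp_add, exp_myArg_eq hu, exp_myArg_eq hv, exp_myArg_eq huv, norm_mul]
      push_cast; rw [div_mul_div_comm]
    rw [Complex.exp_eq_exp_iff_exists_int] at this
    obtain ⟨k, hk⟩ := this
    refine ⟨k, ?_⟩
    have h2 : ((myArg u + myArg v : ℝ) : ℂ) * I = ((myArg (u * v) + 2 * Real.pi * k : ℝ) : ℂ) * I := by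
      push_cast; rw [hk]; ring
    exact_mod_cast mul_right_cancel₀ I_ne_zero h2
  obtain ⟨k, hk⟩ := hk
  have hpi := Real.pi_pos
  have hsq : sqr u * sqr v = cexp (Real.pi * I * k) * sqr (u * v) := by
    unfold sqr
    rw [← Complex.exp_add, ← Complex.exp_add]
    congr 1
    have : (myArg u : ℂ) + myArg v = myArg (u * v) + 2 * Real.pi * k := by exact_mod_cast hk
    linear_combination (I / 2) * this
  rw [hsq]
  congr 1
  have e0 : k = 0 → cexp (Real.pi * I * k) = 1 := by rintro rfl; simp
  have e1 : k = 1 → cexp (Real.pi * I * k) = -1 := by rintro rfl; simp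
  have e2 : k = -1 → cexp (Real.pi * I * k) = -1 := by
    rintro rfl; push_cast; rw [mul_neg, mul_one, Complex.exp_neg, exp_pi_mul_I]; norm_num
  have bd : ∀ a b : ℤ, (2 * Real.pi * a < 2 * Real.pi * k) → (2 * Real.pi * k < 2 * Real.pi * b) →
      a < k ∧ k < b := by
    intro a b h1 h2
    constructor
    · exact_mod_cast lt_of_mul_lt_mul_left h1 (by positivity)
    · exact_mod_cast lt_of_mul_lt_mul_left h2 (by positivity)
  rcases lt_or_gt_of_ne (xC_ne_zero hu) with a | a <;>
  rcases lt_or_gt_of_ne (xC_ne_zero hv) with b | b <;>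
  rcases lt_or_gt_of_ne (xC_ne_zero huv) with c | c
  · have := myArg_neg a; have := myArg_neg b; have := myArg_neg c
    have h := bd (-1) 1 (by push_cast; linarith) (by push_cast; linarith)
    rw [e0 (by omega)]
    simp [eps, hilb, a, b, c, mul_pos_of_neg_of_neg a b]
  · have := myArg_neg a; have := myArg_neg b; have := myArg_pos c
    have h := bd (-2) 0 (by push_cast; linarith) (by push_cast; linarith)
    rw [e2 (by omega)]
    simp [eps, hilb, a, b, c.not_gt]
  · have := myArg_neg a; have := myArg_pos b; have := myArg_neg c
    have h := bd (-1) 1 (by push_cast; linarith) (by push_cast; linarith)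
    rw [e0 (by omega)]
    simp [eps, hilb, a, b.not_gt, c, (mul_neg_of_neg_of_pos a b).not_gt]
  · have := myArg_neg a; have := myArg_pos b; have := myArg_pos c
    have h := bd (-1) 1 (by push_cast; linarith) (by push_cast; linarith)
    rw [e0 (by omega)]
    simp [eps, hilb, b.not_gt, c.not_gt]
  · have := myArg_pos a; have := myArg_neg b; have := myArg_neg c
    have h := bd (-1) 1 (by push_cast; linarith) (by push_cast; linarith)
    rw [e0 (by omega)]
    simp [eps, hilb, a.not_gt, (mul_neg_of_pos_of_neg a b).not_gt]
  · have := myArg_pos a; have := myArg_neg b; have := myArg_pos c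
    have h := bd (-1) 1 (by push_cast; linarith) (by push_cast; linarith)
    rw [e0 (by omega)]
    simp [eps, hilb, a.not_gt, c.not_gt]
  · have := myArg_pos a; have := myArg_pos b; have := myArg_neg c
    have h := bd 0 2 (by push_cast; linarith) (by push_cast; linarith)
    rw [e1 (by omega)]
    simp [eps, hilb, a.not_gt, c, mul_pos a b]
  · have := myArg_pos a; have := myArg_pos b; have := myArg_pos c
    have h := bd (-1) 1 (by push_cast; linarith) (by push_cast; linarith)
    rw [e0 (by omega)]
    simp [eps, hilb, a.not_gt, c.not_gt]

abbrev M2 := Matrix (Fin 2) (Fin 2) ℝ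

def jF (g : M2) (z : ℂ) : ℂ := (g 1 0 : ℂ) * z + (g 1 1 : ℂ)

lemma sbar_eq (g : M2) : sbar g = sqr (jF g Complex.I) := rfl

lemma jF_im (g : M2) (z : ℂ) : (jF g z).im = g 1 0 * z.im := by simp [jF]
lemma jF_re (g : M2) (z : ℂ) : (jF g z).re = g 1 0 * z.re + g 1 1 := by simp [jF]

lemma xEnt_ne_zero {g : M2} (hg : g.det = 1) : xEnt g ≠ 0 := by
  rw [Matrix.det_fin_two] at hg
  unfold xEnt
  split_ifs with h
  · intro h2; rw [h, h2] at hg; simp at hg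
  · exact h

lemma xC_jF (g : M2) {z : ℂ} (hz : 0 < z.im) :
    ∃ t : ℝ, 0 < t ∧ xC (jF g z) = t * xEnt g := by
  unfold xC xEnt
  rw [jF_im, jF_re]
  by_cases h : g 1 0 = 0
  · exact ⟨1, one_pos, by simp [h]⟩
  · exact ⟨z.im, hz, by simp [h, hz.ne', mul_comm]⟩

lemma jF_ne_zero {g : M2} (hg : g.det = 1) {z : ℂ} (hz : 0 < z.im) : jF g z ≠ 0 := by
  intro h
  obtain ⟨t, ht, h2⟩ := xC_jF g hz
  rw [h] at h2
  simp [xC, ht.ne', xEnt_ne_zero hg] at h2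

lemma mobius_sub {g : M2} (hg : g.det = 1) {z w : ℂ} (hz : 0 < z.im) (hw : 0 < w.im) :
    mobius g z - (starRingEnd ℂ) (mobius g w) =
      (z - (starRingEnd ℂ) w) / (jF g z * (starRingEnd ℂ) (jF g w)) := by
  have h1 := jF_ne_zero hg hz
  have h2 : (starRingEnd ℂ) (jF g w) ≠ 0 := by simpa using jF_ne_zero hg hw
  rw [Matrix.det_fin_two] at hg
  have hg' : (g 0 0 : ℂ) * g 1 1 - g 0 1 * g 1 0 = 1 := by exact_mod_cast hg
  unfold mobius
  change _ / jF g z - (starRingEnd ℂ) (_ / jF g w) = _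
  rw [map_div₀, div_sub_div _ _ h1 h2]
  congr 1
  simp only [jF, map_add, map_mul, Complex.conj_ofReal]
  linear_combination (z - (starRingEnd ℂ) w) * hg'

lemma mobius_im {g : M2} (hg : g.det = 1) {z : ℂ} (hz : 0 < z.im) :
    (mobius g z).im = z.im / ‖jF g z‖ ^ 2 := by
  have h := mobius_sub hg hz hz
  rw [Complex.mul_conj, Complex.normSq_eq_norm_sq, Complex.sub_conj, Complex.sub_conj] at h
  have h2 := congrArg Complex.im h
  rw [Complex.div_ofReal_im] at h2
  simp at h2
  linarith [h2, mul_div_assoc 2 z.im (‖jF g z‖ ^ 2)]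

lemma mobius_im_pos {g : M2} (hg : g.det = 1) {z : ℂ} (hz : 0 < z.im) : 0 < (mobius g z).im := by
  rw [mobius_im hg hz]
  have := norm_pos_iff.2 (jF_ne_zero hg hz)
  positivity

lemma jF_mul (g h : M2) (hh : h.det = 1) {z : ℂ} (hz : 0 < z.im) :
    jF (g * h) z = jF g (mobius h z) * jF h z := by
  have h1 := jF_ne_zero hh hz
  rw [show jF g (mobius h z) = g 1 0 * (((h 0 0 : ℂ) * z + h 0 1) / jF h z) + g 1 1 from rfl, add_mul, mul_assoc,
    div_mul_cancel₀ _ h1]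
  simp [jF, Matrix.mul_apply, Fin.sum_univ_two]
  ring

lemma mobius_mul (g h : M2) (hg : g.det = 1) (hh : h.det = 1) {z : ℂ} (hz : 0 < z.im) :
    mobius (g * h) z = mobius g (mobius h z) := by
  have h1 := jF_ne_zero hh hz
  have h2 := jF_ne_zero hg (mobius_im_pos hh hz)
  have h3 := jF_mul g h hh hz
  have : mobius (g * h) z = (((g*h) 0 0 : ℝ) * z + ((g*h) 0 1 : ℝ)) / jF (g * h) z := rfl
  rw [this, h3]
  have : mobius g (mobius h z) = ((g 0 0 : ℂ) * (((h 0 0 : ℂ) * z + h 0 1) / jF h z) + g 0 1) / jF g (mobius h z) := rfl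
  rw [this]
  field_simp
  simp [jF, Matrix.mul_apply, Fin.sum_univ_two]
  ring

lemma eps_scale (x y z a b c : ℝ) (ha : 0 < a) (hb : 0 < b) (hc : 0 < c) :
    eps (a * x) (b * y) (c * z) = eps x y z := by
  have h (t r : ℝ) (ht : 0 < t) : t * r < 0 ↔ r < 0 := by
    constructor
    · intro h; by_contra h2; push Not at h2; nlinarith [mul_nonneg ht.le h2]
    · intro h; nlinarith [mul_pos ht (neg_pos.2 h)]
  unfold eps hilb
  rw [show -(a * x * (b * y)) = (a * b) * (-(x * y)) by ring]
  simp only [h _ _ ha, h _ _ hb, h _ _ hc, h _ _ (mul_pos ha hb)]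

lemma rao_sq (g h : M2) (hg : g.det = 1) (hh : h.det = 1) {z : ℂ} (hz : 0 < z.im) :
    (raoC g h : ℂ) * sqr (jF (g * h) z) = sqr (jF g (mobius h z)) * sqr (jF h z) := by
  have hz' := mobius_im_pos hh hz
  rw [← sq_mul_sq (jF_ne_zero hg hz') (jF_ne_zero hh hz), ← jF_mul g h hh hz]
  obtain ⟨a, ha, ha'⟩ := xC_jF g hz'
  obtain ⟨b, hb, hb'⟩ := xC_jF h hz
  obtain ⟨c, hc, hc'⟩ := xC_jF (g * h) hz
  rw [ha', hb', hc', eps_scale _ _ _ _ _ _ ha hb hc]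
  rfl

lemma rao_cocycle (g h k : M2) (hg : g.det = 1) (hh : h.det = 1) (hk : k.det = 1) :
    (raoC g (h * k) : ℂ) * raoC h k = raoC g h * raoC (g * h) k := by
  have hI : 0 < Complex.I.im := by simp
  have hkI := mobius_im_pos hk hI
  have a1 := rao_sq (g * h) k (by rw [Matrix.det_mul, hg, hh, one_mul]) hk hI
  have a2 := rao_sq g h hg hh hkI
  have a3 := rao_sq h k hh hk hI
  have a4 := rao_sq g (h * k) hg (by rw [Matrix.det_mul, hk, hh, one_mul]) hI
  rw [mobius_mul h k hh hk hI, ← mul_assoc] at a4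
  have := sqr_ne_zero' (jF (g * h * k) Complex.I)
  apply mul_right_cancel₀ this
  linear_combination (raoC h k : ℂ) * a4 + sqr (jF g (mobius h (mobius k Complex.I))) * a3 -
    raoC g h * a1 - sqr (jF k Complex.I) * a2

lemma rao_sq_one (g h : M2) : (raoC g h : ℂ) * raoC g h = 1 := by
  unfold raoC hilb
  split_ifs <;> simp

open Complex in
lemma gammaK_eq {z w : ℂ} (hz : 0 < z.im) (hw : 0 < w.im)  :
    gammaK z w = cexp (-(Real.log ‖(z - (starRingEnd ℂ) w) / (2 * I)‖ +
      arg ((z - (starRingEnd ℂ) w) / (2 * I)) * I) / 2 + Real.log z.im / 4 + Real.log w.im / 4) := by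
  have h0 : (z - (starRingEnd ℂ) w) / (2 * I) ≠ 0 := by
    have : (z - (starRingEnd ℂ) w) ≠ 0 := by
      intro h
      have := congrArg Complex.im h
      simp at this; linarith
    exact div_ne_zero this (by simp)
  unfold gammaK
  rw [cpow_def_of_ne_zero h0, Real.rpow_def_of_pos hz, Real.rpow_def_of_pos hw, Complex.exp_add, Complex.exp_add]
  push_cast
  congr 2
  · rw [Complex.log]; congr 1; ring
  · congr 1; ring
  · congr 1; ring

open Complex in
lemma A_re_pos {z w : ℂ} (hz : 0 < z.im) (hw : 0 < w.im) :
    0 < ((z - (starRingEnd ℂ) w) / (2 * I)).re := by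
  have : ((z - (starRingEnd ℂ) w) / (2 * I)) = ((1/2 : ℝ) : ℂ) * ((z - (starRingEnd ℂ) w) * (-I)) := by
    rw [div_eq_mul_inv, mul_inv, inv_I]; push_cast; ring
  rw [this, re_ofReal_mul]
  simp
  linarith

open Complex in
lemma gammaK_smul {g : M2} (hg : g.det = 1) {z w : ℂ} (hz : 0 < z.im) (hw : 0 < w.im) :
    gammaK (mobius g z) (mobius g w) * sqr (jF g w) = gammaK z w * sqr (jF g z) := by
  have hz' := mobius_im_pos hg hz
  have hw' := mobius_im_pos hg hw
  have hA := A_re_pos hz hw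
  have hA' := A_re_pos hz' hw'
  rw [gammaK_eq hz hw, gammaK_eq hz' hw']
  have hu := jF_ne_zero hg hz
  have hv := jF_ne_zero hg hw
  have hAA : (mobius g z - (starRingEnd ℂ) (mobius g w)) / (2 * I) =
      (z - (starRingEnd ℂ) w) / (2 * I) / (jF g z * (starRingEnd ℂ) (jF g w)) := by
    rw [mobius_sub hg hz hw]; ring
  have hxx : (0 < xC (jF g z) ∧ 0 < xC (jF g w)) ∨ (xC (jF g z) < 0 ∧ xC (jF g w) < 0) := by
    obtain ⟨a, ha, ha'⟩ := xC_jF g hz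
    obtain ⟨b, hb, hb'⟩ := xC_jF g hw
    rw [ha', hb']
    rcases lt_or_gt_of_ne (xEnt_ne_zero hg) with c | c
    · right; exact ⟨mul_neg_of_pos_of_neg ha c, mul_neg_of_pos_of_neg hb c⟩
    · left; exact ⟨mul_pos ha c, mul_pos hb c⟩
  have him1 := mobius_im hg hz
  have him2 := mobius_im hg hw
  set A := (z - (starRingEnd ℂ) w) / (2 * I) with hAd
  set A' := (mobius g z - (starRingEnd ℂ) (mobius g w)) / (2 * I) with hAd'
  set u := jF g z
  set v := jF g w
  have hA0 : A ≠ 0 := by rintro h; rw [h] at hA; simp at hA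
  have hA0' : A' ≠ 0 := by rintro h; rw [h] at hA'; simp at hA'
  have nu := norm_pos_iff.2 hu
  have nv := norm_pos_iff.2 hv
  have nA := norm_pos_iff.2 hA0
  have n1 : Real.log ‖A'‖ = Real.log ‖A‖ - (Real.log ‖u‖ + Real.log ‖v‖) := by
    rw [hAA, norm_div, norm_mul, RCLike.norm_conj, Real.log_div nA.ne' (mul_pos nu nv).ne',
      Real.log_mul nu.ne' nv.ne']
  have n2 : Real.log (mobius g z).im = Real.log z.im - 2 * Real.log ‖u‖ := by
    rw [him1, Real.log_div hz.ne' (by positivity), Real.log_pow]; norm_num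
  have n3 : Real.log (mobius g w).im = Real.log w.im - 2 * Real.log ‖v‖ := by
    rw [him2, Real.log_div hw.ne' (by positivity), Real.log_pow]; norm_num
  have n4 : arg A' = arg A - myArg u + myArg v := by
    have hk : ∃ k : ℤ, arg A' = arg A - myArg u + myArg v + 2 * Real.pi * k := by
      have : cexp (arg A' * I) = cexp ((arg A - myArg u + myArg v) * I) := by
        have c1 : ∀ x : ℂ, x ≠ 0 → cexp (arg x * I) = x / ‖x‖ := fun x hx => by
          rw [← exp_myArg, exp_myArg_eq hx]
        rw [add_mul, sub_mul, Complex.exp_add, Complex.exp_sub, c1 _ hA0', c1 _ hA0, exp_myArg_eq hu,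
          exp_myArg_eq hv, hAA, norm_div, norm_mul, RCLike.norm_conj]
        have hvv : v * (starRingEnd ℂ) v = (‖v‖ : ℂ) ^ 2 := by
          rw [mul_conj, normSq_eq_norm_sq]; push_cast; rfl
        have q1 : (‖u‖ : ℂ) ≠ 0 := by exact_mod_cast nu.ne'
        have q2 : (‖v‖ : ℂ) ≠ 0 := by exact_mod_cast nv.ne'
        have q3 : (‖A‖ : ℂ) ≠ 0 := by exact_mod_cast nA.ne'
        have q4 : (starRingEnd ℂ) v ≠ 0 := by simpa using hv
        push_cast
        field_simp
        linear_combination -hvv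
      rw [Complex.exp_eq_exp_iff_exists_int] at this
      obtain ⟨k, hk⟩ := this
      refine ⟨k, ?_⟩
      have h2 : ((arg A' : ℝ) : ℂ) * I = ((arg A - myArg u + myArg v + 2 * Real.pi * k : ℝ) : ℂ) * I := by
        push_cast; rw [hk]; ring
      exact_mod_cast mul_right_cancel₀ I_ne_zero h2
    obtain ⟨k, hk⟩ := hk
    have b1 := abs_lt.1 (abs_arg_lt_pi_div_two_iff.2 (Or.inl hA))
    have b2 := abs_lt.1 (abs_arg_lt_pi_div_two_iff.2 (Or.inl hA'))
    have b3 : -Real.pi < myArg u - myArg v ∧ myArg u - myArg v < Real.pi := by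
      rcases hxx with ⟨h1, h2⟩ | ⟨h1, h2⟩
      · have := myArg_pos h1; have := myArg_pos h2
        constructor <;> linarith
      · have := myArg_neg h1; have := myArg_neg h2
        constructor <;> linarith
    have hpi := Real.pi_pos
    have l1 : (k : ℝ) < 1 := by
      apply lt_of_mul_lt_mul_left (a := 2 * Real.pi) _ (by positivity); linarith
    have l2 : (-1 : ℝ) < k := by
      apply lt_of_mul_lt_mul_left (a := 2 * Real.pi) _ (by positivity); linarith
    have l3 : k = 0 := by
      have l1' : k < 1 := by exact_mod_cast l1
      have l2' : -1 < k := by exact_mod_cast l2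
      omega
    rw [hk, l3]; simp
  unfold sqr
  rw [← Complex.exp_add, ← Complex.exp_add, n1, n2, n3, n4]
  congr 1
  push_cast
  ring

lemma chat_eq (g h : M2) (hg : g.det = 1) (hh : h.det = 1) :
    chat g h = raoC g h * (sbar g * sbar h / sbar (g * h)) := by
  have hI : 0 < Complex.I.im := by simp
  have hhI := mobius_im_pos hh hI
  have e1 := gammaK_smul hg hI hhI
  have e2 := rao_sq g h hg hh hI
  have e3 := rao_sq_one g h
  have hG : gammaK Complex.I (mobius h Complex.I) ≠ 0 := by
    rw [gammaK_eq hI hhI]; exact Complex.exp_ne_zero _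
  unfold chat
  rw [mobius_mul g h hg hh hI, sbar_eq, sbar_eq, sbar_eq, div_eq_iff hG]
  have s1 := sqr_ne_zero' (jF g (mobius h Complex.I))
  have s2 := sqr_ne_zero' (jF (g * h) Complex.I)
  apply mul_right_cancel₀ s1
  rw [e1]
  field_simp
  linear_combination (-(sqr (jF g Complex.I) * sqr (jF (g*h) Complex.I))) * e3 + sqr (jF g Complex.I) * raoC g h * e2
abbrev MZ := Matrix (Fin 2) (Fin 2) ℤ

lemma gaussG_pos (d : ℤ) (q : ℕ) : gaussG d (q : ℤ) = gN (-d) q := by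
  unfold gaussG gN gS
  simp only [Int.natAbs_natCast]
  congr 1
  refine Finset.sum_congr rfl fun n _ => ?_
  congr 1
  push_cast
  ring

lemma gaussG_neg (d : ℤ) (q : ℕ) : gaussG d (-(q : ℤ)) = gN d q := by
  unfold gaussG gN gS
  simp only [Int.natAbs_natCast, Int.natAbs_neg]
  congr 1
  refine Finset.sum_congr rfl fun n _ => ?_
  congr 1
  push_cast
  rw [div_neg]
  ring

lemma gaussG_shift (c d k : ℤ) (hc : c ≠ 0) : gaussG (d + 2 * k * c) c = gaussG d c := by
  unfold gaussG
  congr 1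
  refine Finset.sum_congr rfl fun n _ => ?_
  have hc' : (c : ℂ) ≠ 0 := by exact_mod_cast hc
  rw [← one_mul (Complex.exp (-(Real.pi : ℂ) * Complex.I * (d : ℂ) * (n : ℂ) ^ 2 / (c : ℂ))),
    ← exp_even_aux (2 * (-k * n ^ 2)) (even_two_mul _), ← Complex.exp_add]
  congr 1
  push_cast
  field_simp
  ring

def bR (c d : ℤ) : ℂ :=
  if c = 0 then
    Complex.exp (-(Complex.I * (Real.pi : ℂ) / 4) * ((1 : ℂ) - (Int.sign d : ℂ)))
  else gaussG d c *
    Complex.exp (Complex.I * (Real.pi : ℂ) / 4 * (Int.sign c : ℂ))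

lemma betaBar_eq (g : MZ) : betaBar g = bR (g 1 0) (g 1 1) := rfl

lemma bR_shift (c d k : ℤ) : bR c (d + 2 * k * c) = bR c d := by
  unfold bR
  split_ifs with h
  · subst h; simp
  · rw [gaussG_shift _ _ _ h]

open Complex in
lemma zeta_sq : cexp (I * Real.pi / 4) * cexp (I * Real.pi / 4) = I := by
  rw [← Complex.exp_add]
  have := exp_pi_div_two_mul_I
  rw [show I * (Real.pi : ℂ) / 4 + I * Real.pi / 4 = Real.pi / 2 * I by ring, this]

open Complex in
lemma bR_zero_one : bR 0 1 = 1 := by simp [bR]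
open Complex in
lemma bR_zero_neg_one : bR 0 (-1) = -I := by
  have := zeta_sq
  rw [← Complex.exp_add] at this
  simp only [bR, if_true]
  rw [show -(I * (Real.pi : ℂ) / 4) * (1 - (Int.sign (-1) : ℂ)) = -(I * Real.pi / 4 + I * Real.pi / 4) by
    simp; ring, Complex.exp_neg, this, inv_I]
open Complex in
lemma gN_zero_one : gN 0 1 = 1 := by simp [gN, gS]
open Complex in
lemma bR_pos (q : ℕ) (hq : 0 < q) (d : ℤ) : bR q d = gN (-d) q * cexp (I * Real.pi / 4) := by
  rw [bR, if_neg (by omega), gaussG_pos, Int.sign_eq_one_of_pos (by omega)]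
  simp
open Complex in
lemma bR_neg (q : ℕ) (hq : 0 < q) (d : ℤ) : bR (-(q:ℤ)) d = gN d q * (cexp (I * Real.pi / 4))⁻¹ := by
  rw [bR, if_neg (by omega), gaussG_neg, Int.sign_eq_neg_one_of_neg (by omega), ← Complex.exp_neg]
  congr 2
  push_cast; ring

def xZ (c d : ℤ) : ℝ := if c = 0 then (d : ℝ) else c

open Complex in
lemma bR_S (c d : ℤ) (hcd : IsCoprime c d) (he : Even (c * d)) :
    bR d (-c) = (hilb (-(xZ c d)) (xZ d (-c)) : ℂ) * cexp (I * Real.pi / 4) * bR c d := by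
  have hz := zeta_sq
  have hz0 := Complex.exp_ne_zero (I * Real.pi / 4)
  have c10 := bR_pos 1 one_pos 0
  have c20 := bR_neg 1 one_pos 0
  simp only [Nat.cast_one, neg_zero, gN_zero_one, one_mul] at c10 c20
  have c3 := bR_zero_one
  have c4 := bR_zero_neg_one
  rcases eq_or_ne c 0 with rfl | hc
  · rw [isCoprime_zero_left, Int.isUnit_iff] at hcd
    rcases hcd with rfl | rfl
    · simp [c10, c3, hilb, xZ]
    · simp only [neg_zero, c20, c4, hilb, xZ]
      rw [if_neg (by norm_num)]
      field_simp
      rw [pow_two, hz]; simp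
  rcases eq_or_ne d 0 with rfl | hd
  · rw [isCoprime_zero_right, Int.isUnit_iff] at hcd
    rcases hcd with rfl | rfl
    · simp only [c10, c4, hilb, xZ]
      rw [if_pos (by norm_num), mul_assoc, hz]; simp
    · simp only [c20, neg_neg, c3, hilb, xZ]
      rw [if_neg (by norm_num)]
      field_simp; simp
  have hI : (cexp (I * Real.pi / 4)) ^ 2 = I := by rw [pow_two, hz]
  have hI4 : (cexp (I * Real.pi / 4)) ^ 4 = -1 := by
    rw [show 4 = 2 * 2 from rfl, pow_mul, hI, I_sq]
  obtain ⟨p, rfl | rfl⟩ := c.eq_nat_or_neg <;> obtain ⟨q, rfl | rfl⟩ := d.eq_nat_or_neg <;>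
    have hp : 0 < p := (by omega : 0 < p) <;> have hq : 0 < q := (by omega : 0 < q) <;>
    have hpR : (0:ℝ) < p := (by exact_mod_cast hp : (0:ℝ) < p) <;>
    have hqR : (0:ℝ) < q := (by exact_mod_cast hq : (0:ℝ) < q)
  · have r := gN_recip p q hp hq (by exact_mod_cast he)
    rw [bR_pos q hq, bR_pos p hp, neg_neg, r]
    simp only [hilb, xZ, if_neg hc, if_neg hd]
    rw [if_neg (by push_cast; rintro ⟨h1, h2⟩; linarith)]
    push_cast; ring
  · have r := gN_recip q p hq hp (by
      rw [mul_neg, even_neg] at he; rw [mul_comm]; exact_mod_cast he)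
    rw [bR_neg q hq, bR_pos p hp, neg_neg, r]
    simp only [hilb, xZ, if_neg hc, if_neg hd]
    rw [if_pos (by push_cast; constructor <;> linarith)]
    push_cast; field_simp
    rw [hI4]; ring
  · have r := gN_recip q p hq hp (by
      rw [neg_mul, even_neg] at he; rw [mul_comm]; exact_mod_cast he)
    rw [bR_pos q hq, bR_neg p hp, neg_neg, r]
    simp only [hilb, xZ, if_neg hc, if_neg hd]
    rw [if_neg (by push_cast; rintro ⟨h1, h2⟩; linarith)]
    push_cast; field_simp
  · have r := gN_recip p q hp hq (by
      rw [neg_mul, even_neg, mul_neg, even_neg] at he; exact_mod_cast he)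
    rw [bR_neg q hq, bR_neg p hp, neg_neg, r]
    simp only [hilb, xZ, if_neg hc, if_neg hd]
    rw [if_neg (by push_cast; rintro ⟨h1, h2⟩; linarith)]
    push_cast; field_simp

def inT (g : MZ) : Prop := g.det = 1 ∧ Even (g 0 0 * g 1 0) ∧ Even (g 0 1 * g 1 1)

lemma inT_mul {g h : MZ} (hg : inT g) (hh : inT h) : inT (g * h) := by
  obtain ⟨a1, a2, a3⟩ := hg
  obtain ⟨b1, b2, b3⟩ := hh
  refine ⟨by rw [Matrix.det_mul, a1, b1, one_mul], ?_⟩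
  rw [Matrix.det_fin_two] at a1 b1
  have a4 : ¬ Even (g 0 0 * g 1 1 - g 0 1 * g 1 0) := by rw [a1]; decide
  have b4 : ¬ Even (h 0 0 * h 1 1 - h 0 1 * h 1 0) := by rw [b1]; decide
  simp only [Matrix.mul_apply, Fin.sum_univ_two, Int.even_add, Int.even_mul, Int.even_sub] at *
  tauto

def Sm : MZ := !![0, -1; 1, 0]
def Tm (k : ℤ) : MZ := !![1, 2 * k; 0, 1]

lemma inT_S : inT Sm := by
  refine ⟨by simp [Sm, Matrix.det_fin_two], by simp [Sm], by simp [Sm]⟩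
lemma inT_T (k : ℤ) : inT (Tm k) := by
  refine ⟨by simp [Tm, Matrix.det_fin_two], by simp [Tm], by simp [Tm]⟩

def Good (h : MZ) : Prop :=
  inT h ∧ ∀ g, inT g → betaBar (g * h) = (raoC (toR g) (toR h) : ℂ) * betaBar g * betaBar h

lemma toR_mul (g h : MZ) : toR (g * h) = toR g * toR h := by
  ext i j; simp [toR, Matrix.mul_apply]

lemma toR_det {g : MZ} (hg : g.det = 1) : (toR g).det = 1 := by
  rw [Matrix.det_fin_two] at *
  simp only [toR, Matrix.map_apply]
  exact_mod_cast hg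

lemma xEnt_toR (g : MZ) : xEnt (toR g) = xZ (g 1 0) (g 1 1) := by
  simp [xEnt, toR, xZ]

lemma Good_mul {h k : MZ} (hh : Good h) (hk : Good k) : Good (h * k) := by
  refine ⟨inT_mul hh.1 hk.1, fun g hg => ?_⟩
  have e1 := hk.2 (g * h) (inT_mul hg hh.1)
  have e2 := hh.2 g hg
  have e3 := hk.2 h hh.1
  have e4 := rao_cocycle _ _ _ (toR_det hg.1) (toR_det hh.1.1) (toR_det hk.1.1)
  rw [← mul_assoc, e1, e2, e3, toR_mul, toR_mul]
  linear_combination -(betaBar g * betaBar h * betaBar k) * e4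

lemma raoC_toR (g h : MZ) : raoC (toR g) (toR h) =
    eps (xZ (g 1 0) (g 1 1)) (xZ (h 1 0) (h 1 1)) (xZ ((g*h) 1 0) ((g*h) 1 1)) := by
  unfold raoC eps
  rw [← toR_mul, xEnt_toR, xEnt_toR, xEnt_toR]

lemma Good_T (k : ℤ) : Good (Tm k) := by
  refine ⟨inT_T k, fun g hg => ?_⟩
  have e1 : (g * Tm k) 1 0 = g 1 0 := by simp [Tm, Matrix.mul_apply, Fin.sum_univ_two]
  have e2 : (g * Tm k) 1 1 = g 1 1 + 2 * k * g 1 0 := by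
    simp [Tm, Matrix.mul_apply, Fin.sum_univ_two]; ring
  have e3 : betaBar (Tm k) = 1 := by rw [betaBar_eq]; simp [Tm, bR]
  rw [raoC_toR, e3, betaBar_eq, betaBar_eq, e1, e2, bR_shift]
  have e4 : xZ (g 1 0) (g 1 1 + 2 * k * g 1 0) = xZ (g 1 0) (g 1 1) := by
    unfold xZ; split_ifs with h
    · rw [h]; simp
    · rfl
  have e5 : xZ (Tm k 1 0) (Tm k 1 1) = 1 := by simp [xZ, Tm]
  rw [e4, e5]
  have : eps (xZ (g 1 0) (g 1 1)) 1 (xZ (g 1 0) (g 1 1)) = 1 := by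
    unfold eps hilb
    rw [if_neg (by rintro ⟨_, h⟩; linarith), if_neg (by rintro ⟨h, h2⟩; linarith)]; norm_num
  rw [this]; simp

lemma inT_even {g : MZ} (hg : inT g) : Even (g 1 0 * g 1 1) := by
  obtain ⟨a1, a2, a3⟩ := hg
  rw [Matrix.det_fin_two] at a1
  have a4 : ¬ Even (g 0 0 * g 1 1 - g 0 1 * g 1 0) := by rw [a1]; decide
  simp only [Int.even_mul, Int.even_sub] at *
  tauto

lemma Good_S : Good Sm := by
  refine ⟨inT_S, fun g hg => ?_⟩
  have e1 : (g * Sm) 1 0 = g 1 1 := by simp [Sm, Matrix.mul_apply, Fin.sum_univ_two]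
  have e2 : (g * Sm) 1 1 = - g 1 0 := by
    simp [Sm, Matrix.mul_apply, Fin.sum_univ_two]
  have e3 : betaBar Sm = Complex.exp (Complex.I * Real.pi / 4) := by
    have := bR_pos 1 one_pos 0
    rw [betaBar_eq]; simpa [Sm, gN_zero_one] using this
  have e5 : xZ (Sm 1 0) (Sm 1 1) = 1 := by simp [xZ, Sm]
  have hco : IsCoprime (g 1 0) (g 1 1) := by
    have := hg.1
    rw [Matrix.det_fin_two] at this
    exact ⟨- g 0 1, g 0 0, by linarith⟩
  rw [raoC_toR, e3, betaBar_eq, betaBar_eq, e1, e2, bR_S _ _ hco (inT_even hg), e5]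
  have : eps (xZ (g 1 0) (g 1 1)) 1 (xZ (g 1 1) (-g 1 0)) =
      hilb (-(xZ (g 1 0) (g 1 1))) (xZ (g 1 1) (-g 1 0)) := by
    unfold eps
    rw [mul_one, show hilb (xZ (g 1 0) (g 1 1)) 1 = 1 by
      unfold hilb; rw [if_neg (by rintro ⟨_, h⟩; linarith)], one_mul]
  rw [this]; ring

lemma Good_all : ∀ (n : ℕ) (g : MZ), (g 1 0).natAbs = n → inT g → Good g := by
  intro n
  induction n using Nat.strong_induction_on with
  | _ n ih =>
  intro g hn hg
  have hdet := hg.1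
  rw [Matrix.det_fin_two] at hdet
  by_cases hc : g 1 0 = 0
  · rw [hc, mul_zero, sub_zero] at hdet
    have hev := hg.2.2
    rcases Int.eq_one_or_neg_one_of_mul_eq_one' hdet with ⟨h1, h2⟩ | ⟨h1, h2⟩
    · rw [h2, mul_one] at hev
      obtain ⟨m, hm⟩ := hev
      have : g = Tm m := by
        ext i j
        fin_cases i <;> fin_cases j <;> simp [Tm, h1, h2, hc, hm]; ring
      rw [this]; exact Good_T m
    · rw [h2, mul_neg, even_neg, mul_one] at hev
      obtain ⟨m, hm⟩ := hev
      have : g = Sm * Sm * Tm (-m) := by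
        ext i j
        fin_cases i <;> fin_cases j <;>
          simp [Tm, Sm, h1, h2, hc, hm]; ring
      rw [this]; exact Good_mul (Good_mul Good_S Good_S) (Good_T _)
  · have hk : ∃ k : ℤ, (g 1 1 + 2 * k * g 1 0).natAbs ≤ (g 1 0).natAbs := by
      have hpos : 0 < 2 * |g 1 0| := by positivity
      have r1 := Int.emod_nonneg (g 1 1) hpos.ne'
      have r2 := Int.emod_lt_of_pos (g 1 1) hpos
      have r3 := Int.emod_add_mul_ediv (g 1 1) (2 * |g 1 0|)
      have hs : ∃ s : ℤ, |g 1 0| = s * g 1 0 := by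
        rcases abs_choice (g 1 0) with h | h
        · exact ⟨1, by rw [h]; ring⟩
        · exact ⟨-1, by rw [h]; ring⟩
      obtain ⟨s, hs⟩ := hs
      by_cases hr : g 1 1 % (2 * |g 1 0|) ≤ |g 1 0|
      · refine ⟨- s * (g 1 1 / (2 * |g 1 0|)), ?_⟩
        have : g 1 1 + 2 * (- s * (g 1 1 / (2 * |g 1 0|))) * g 1 0 = g 1 1 % (2 * |g 1 0|) := by
          have : 2 * |g 1 0| * (g 1 1 / (2 * |g 1 0|)) = 2 * (s * g 1 0) * (g 1 1 / (2 * |g 1 0|)) := by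
            rw [← hs]
          linarith
        rw [this, ← Int.ofNat_le, Int.natCast_natAbs, Int.natCast_natAbs, abs_le]; constructor <;> linarith
      · refine ⟨- s * (g 1 1 / (2 * |g 1 0|)) - s, ?_⟩
        have : g 1 1 + 2 * (- s * (g 1 1 / (2 * |g 1 0|)) - s) * g 1 0 =
            g 1 1 % (2 * |g 1 0|) - 2 * |g 1 0| := by
          have : 2 * |g 1 0| * (g 1 1 / (2 * |g 1 0|)) = 2 * (s * g 1 0) * (g 1 1 / (2 * |g 1 0|)) := by
            rw [← hs]
          linarith
        rw [this, ← Int.ofNat_le, Int.natCast_natAbs, Int.natCast_natAbs, abs_le]; constructor <;> linarith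
    obtain ⟨k, hk⟩ := hk
    have hg' : inT (g * Tm k) := inT_mul hg (inT_T k)
    have hg'' : inT (g * Tm k * Sm) := inT_mul hg' inT_S
    have e1 : (g * Tm k) 1 0 = g 1 0 := by simp [Tm, Matrix.mul_apply, Fin.sum_univ_two]
    have e2 : (g * Tm k) 1 1 = g 1 1 + 2 * k * g 1 0 := by
      simp [Tm, Matrix.mul_apply, Fin.sum_univ_two]; ring
    have e3 : (g * Tm k * Sm) 1 0 = g 1 1 + 2 * k * g 1 0 := by
      rw [← e2]; rw [Matrix.mul_apply]; simp [Sm, Fin.sum_univ_two]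
    have hlt : (g 1 1 + 2 * k * g 1 0).natAbs < (g 1 0).natAbs := by
      refine lt_of_le_of_ne hk fun heq => ?_
      obtain ⟨a1, a2, a3⟩ := hg'
      rw [Matrix.det_fin_two] at a1
      rw [← e2, ← e1, Int.natAbs_eq_natAbs_iff] at heq
      have a4 : ¬ Even ((g * Tm k) 0 0 * (g * Tm k) 1 1 - (g * Tm k) 0 1 * (g * Tm k) 1 0) := by
        rw [a1]; decide
      have a5 : Even ((g * Tm k) 1 1) ↔ Even ((g * Tm k) 1 0) := by
        rcases heq with h | h <;> rw [h]
        rw [even_neg]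
      simp only [Int.even_mul, Int.even_sub] at a2 a3 a4
      tauto
    have hG := ih _ (by rw [← hn]; exact hlt) (g * Tm k * Sm) (by rw [e3]) hg''
    have : g = (g * Tm k * Sm) * (Sm * Sm * Sm) * Tm (-k) := by
      have s4 : Sm * (Sm * Sm * Sm) = 1 := by
        ext i j; fin_cases i <;> fin_cases j <;> simp [Sm]
      have tt : Tm k * Tm (-k) = 1 := by
        ext i j; fin_cases i <;> fin_cases j <;> simp [Tm]
      rw [mul_assoc (g * Tm k), s4, mul_one, mul_assoc, tt, mul_one]
    rw [this]
    exact Good_mul (Good_mul hG (Good_mul (Good_mul Good_S Good_S) Good_S)) (Good_T _)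

lemma betaBar_ne_zero {g : MZ} (hg : inT g) : betaBar g ≠ 0 := by
  have hadj : inT (!![g 1 1, - g 0 1; - g 1 0, g 0 0] : MZ) := by
    have h2 := inT_even hg
    obtain ⟨a1, a2, a3⟩ := hg
    rw [Matrix.det_fin_two] at a1
    have a4 : ¬ Even (g 0 0 * g 1 1 - g 0 1 * g 1 0) := by rw [a1]; decide
    refine ⟨by simp [Matrix.det_fin_two]; linarith, ?_⟩
    simp [Int.even_mul, Int.even_sub] at *
    tauto
  have h := (Good_all _ _ rfl hadj).2 g hg
  have h1 : g * (!![g 1 1, - g 0 1; - g 1 0, g 0 0] : MZ) = 1 := by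
    have a1 := hg.1
    rw [Matrix.det_fin_two] at a1
    ext i j; fin_cases i <;> fin_cases j <;> simp [Matrix.mul_apply, Fin.sum_univ_two] <;> linarith
  rw [h1] at h
  have h2 : betaBar (1 : MZ) = 1 := by rw [betaBar_eq]; simp [bR]
  intro h0
  rw [h0, h2] at h
  simp at h

theorem statement10 (g₁ g₂ : Matrix (Fin 2) (Fin 2) ℤ)
    (h₁ : g₁.det = 1) (h₂ : g₂.det = 1)
    (hθ₁ : Even (g₁ 0 0 * g₁ 1 0) ∧ Even (g₁ 0 1 * g₁ 1 1))
    (hθ₂ : Even (g₂ 0 0 * g₂ 1 0) ∧ Even (g₂ 0 1 * g₂ 1 1)) :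
    (raoC (toR g₁) (toR g₂) : ℂ) = (betaBar g₁)⁻¹ * (betaBar g₂)⁻¹ * betaBar (g₁ * g₂) ∧
    chat (toR g₁) (toR g₂) = (betaHat g₁)⁻¹ * (betaHat g₂)⁻¹ * betaHat (g₁ * g₂) := by
  have i1 : inT g₁ := ⟨h₁, hθ₁⟩
  have i2 : inT g₂ := ⟨h₂, hθ₂⟩
  have b1 := betaBar_ne_zero i1
  have b2 := betaBar_ne_zero i2
  have hE := (Good_all _ _ rfl i2).2 g₁ i1
  have s1 : sbar (toR g₁) ≠ 0 := sqr_ne_zero' _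
  have s2 : sbar (toR g₂) ≠ 0 := sqr_ne_zero' _
  have s3 : sbar (toR g₁ * toR g₂) ≠ 0 := sqr_ne_zero' _
  constructor
  · rw [hE]; field_simp
  · rw [chat_eq _ _ (toR_det h₁) (toR_det h₂)]
    unfold betaHat
    rw [hE, toR_mul]
    field_simp
end
end

section
/- Let N be an odd positive integer. The map from the right-coset space (Γ₀(N) ∩ Γ_θ)\Γ₀(N) to Γ_θ\SL₂(ℤ) sending the coset (Γ₀(N) ∩ Γ_θ)·x to Γ_θ·x is a well-defined bijection. Likewise, the map (Γ(N) ∩ Γ_θ)\Γ(N) → Γ_θ\SL₂(ℤ) sending (Γ(N) ∩ Γ_θ)·x to Γ_θ·x is a well-defined bijection. -/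
noncomputable section

/-- `SL₂(ℤ)` as a set of integer matrices. -/
def SL2ZSet : Set (Matrix (Fin 2) (Fin 2) ℤ) := {g | g.det = 1}

/-- The theta group `Γ_θ`. -/
def GammaTheta : Set (Matrix (Fin 2) (Fin 2) ℤ) :=
  {g | g.det = 1 ∧ Even (g 0 0 * g 1 0) ∧ Even (g 0 1 * g 1 1)}

/-- The congruence subgroup `Γ₀(M)`. -/
def Gamma0 (M : ℕ) : Set (Matrix (Fin 2) (Fin 2) ℤ) := {g | g.det = 1 ∧ (M : ℤ) ∣ g 1 0}

/-- The principal congruence subgroup `Γ(M)`. -/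
def GammaFull (M : ℕ) : Set (Matrix (Fin 2) (Fin 2) ℤ) :=
  {g | g.det = 1 ∧ (M : ℤ) ∣ (g 0 0 - 1) ∧ (M : ℤ) ∣ g 0 1 ∧ (M : ℤ) ∣ g 1 0 ∧
    (M : ℤ) ∣ (g 1 1 - 1)}

/-- The right coset `H·x`. -/
def rcoset (H : Set (Matrix (Fin 2) (Fin 2) ℤ)) (x : Matrix (Fin 2) (Fin 2) ℤ) :
    Set (Matrix (Fin 2) (Fin 2) ℤ) := {g | ∃ r ∈ H, g = r * x}

structure IsGrp (H : Set (Matrix (Fin 2) (Fin 2) ℤ)) : Prop where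
  det : ∀ g ∈ H, g.det = 1
  one : 1 ∈ H
  mul : ∀ g ∈ H, ∀ h ∈ H, g * h ∈ H
  adj : ∀ g ∈ H, g.adjugate ∈ H

lemma IsGrp.inter {H K : Set (Matrix (Fin 2) (Fin 2) ℤ)} (hH : IsGrp H) (hK : IsGrp K) :
    IsGrp (H ∩ K) where
  det g hg := hH.det g hg.1
  one := ⟨hH.one, hK.one⟩
  mul g hg h hh := ⟨hH.mul g hg.1 h hh.1, hK.mul g hg.2 h hh.2⟩
  adj g hg := ⟨hH.adj g hg.1, hK.adj g hg.2⟩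

lemma IsGrp.rcoset_eq {H : Set (Matrix (Fin 2) (Fin 2) ℤ)} (hH : IsGrp H)
    {x y : Matrix (Fin 2) (Fin 2) ℤ} (hx : x.det = 1) (hy : y.det = 1) :
    rcoset H x = rcoset H y ↔ x * y.adjugate ∈ H := by
  have hyy : y * y.adjugate = 1 := by rw [Matrix.mul_adjugate, hy, one_smul]
  have hyy' : y.adjugate * y = 1 := by rw [Matrix.adjugate_mul, hy, one_smul]
  constructor
  · intro h
    have hx1 : x ∈ rcoset H x := ⟨1, hH.one, by simp⟩
    rw [h] at hx1
    obtain ⟨r, hr, e⟩ := hx1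
    rw [e, mul_assoc, hyy, mul_one]
    exact hr
  · intro h
    have e : x = (x * y.adjugate) * y := by rw [mul_assoc, hyy', mul_one]
    have e' : y = (x * y.adjugate).adjugate * x := by
      conv_rhs => rw [e]
      rw [← mul_assoc, mul_assoc x, hyy', mul_one, Matrix.adjugate_mul, hH.det _ h, one_smul, one_mul]
    ext g
    constructor
    · rintro ⟨r, hr, rfl⟩
      refine ⟨r * (x * y.adjugate), hH.mul _ hr _ h, ?_⟩
      rw [mul_assoc r, ← e]
    · rintro ⟨r, hr, rfl⟩
      refine ⟨r * (x * y.adjugate).adjugate, hH.mul _ hr _ (hH.adj _ h), ?_⟩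
      rw [mul_assoc r, ← e']

lemma theta_par {g : Matrix (Fin 2) (Fin 2) ℤ} (a : g.det = 1) (b : Even (g 0 0 * g 1 0))
    (c : Even (g 0 1 * g 1 1)) :
    (¬ Even (g 0 0) ∧ Even (g 0 1) ∧ Even (g 1 0) ∧ ¬ Even (g 1 1)) ∨
    (Even (g 0 0) ∧ ¬ Even (g 0 1) ∧ ¬ Even (g 1 0) ∧ Even (g 1 1)) := by
  rw [Matrix.det_fin_two] at a
  have a' := congrArg Even a
  simp only [Int.even_mul, Int.even_sub, Int.not_even_one, eq_iff_iff] at *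
  tauto

lemma grp_theta : IsGrp GammaTheta where
  det g hg := hg.1
  one := by simp [GammaTheta]
  mul g hg h hh := by
    obtain ⟨a, b, c⟩ := hg
    obtain ⟨d, e, f⟩ := hh
    have hg := theta_par a b c
    have hh := theta_par d e f
    refine ⟨by rw [Matrix.det_mul, a, d, one_mul], ?_, ?_⟩
    all_goals
      simp only [Matrix.mul_apply, Fin.sum_univ_two]
      rcases hg with ⟨g1, g2, g3, g4⟩ | ⟨g1, g2, g3, g4⟩ <;>
      rcases hh with ⟨h1, h2, h3, h4⟩ | ⟨h1, h2, h3, h4⟩ <;>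
      simp only [Int.even_mul, Int.even_add, g1, g2, g3, g4, h1, h2, h3, h4] <;> simp
  adj g hg := by
    obtain ⟨a, b, c⟩ := hg
    refine ⟨by rw [Matrix.det_adjugate, a]; simp, ?_, ?_⟩
    all_goals
      rw [Matrix.det_fin_two] at a
      have a' := congrArg Even a
      simp [Matrix.adjugate_fin_two]
      simp only [Int.even_mul, Int.even_sub, Int.not_even_one, eq_iff_iff] at *
      tauto

lemma grp_0 (N : ℕ) : IsGrp (Gamma0 N) where
  det g hg := hg.1
  one := by simp [Gamma0]
  mul g hg h hh := by
    refine ⟨by rw [Matrix.det_mul, hg.1, hh.1, one_mul], ?_⟩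
    simp only [Matrix.mul_apply, Fin.sum_univ_two]
    exact dvd_add (hg.2.mul_right _) (hh.2.mul_left _)
  adj g hg := by
    refine ⟨by rw [Matrix.det_adjugate, hg.1]; simp, ?_⟩
    simpa [Matrix.adjugate_fin_two] using hg.2

lemma grp_full (N : ℕ) : IsGrp (GammaFull N) where
  det g hg := hg.1
  one := by simp [GammaFull]
  mul g hg h hh := by
    obtain ⟨a, ⟨p, hp⟩, ⟨q, hq⟩, ⟨r, hr⟩, ⟨s, hs⟩⟩ := hg
    obtain ⟨a', ⟨p', hp'⟩, ⟨q', hq'⟩, ⟨r', hr'⟩, ⟨s', hs'⟩⟩ := hh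
    rw [sub_eq_iff_eq_add] at hp hs hp' hs'
    refine ⟨by rw [Matrix.det_mul, a, a', one_mul], ?_, ?_, ?_, ?_⟩ <;>
      simp only [Matrix.mul_apply, Fin.sum_univ_two, hp, hq, hr, hs, hp', hq', hr', hs']
    · exact ⟨N * p * p' + p + p' + N * q * r', by ring⟩
    · exact ⟨N * p * q' + q' + N * q * s' + q, by ring⟩
    · exact ⟨N * r * p' + r + N * s * r' + r', by ring⟩
    · exact ⟨N * r * q' + N * s * s' + s + s', by ring⟩
  adj g hg := by
    obtain ⟨a, hp, hq, hr, hs⟩ := hg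
    refine ⟨by rw [Matrix.det_adjugate, a]; simp, ?_, ?_, ?_, ?_⟩ <;>
      simpa [Matrix.adjugate_fin_two]

lemma full_sub (N : ℕ) : GammaFull N ⊆ Gamma0 N := fun _ hg => ⟨hg.1, hg.2.2.2.1⟩

lemma inj_aux {K : Set (Matrix (Fin 2) (Fin 2) ℤ)} (hK : IsGrp K) :
    ∀ x ∈ K, ∀ y ∈ K, (rcoset (K ∩ GammaTheta) x = rcoset (K ∩ GammaTheta) y ↔
          rcoset GammaTheta x = rcoset GammaTheta y) := by
  intro x hx y hy
  rw [(hK.inter grp_theta).rcoset_eq (hK.det _ hx) (hK.det _ hy),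
    grp_theta.rcoset_eq (hK.det _ hx) (hK.det _ hy)]
  exact ⟨fun h => h.2, fun h => ⟨hK.mul _ hx _ (hK.adj _ hy), h⟩⟩

lemma surj_aux (N : ℕ) (hN : Odd N) :
    ∀ g ∈ SL2ZSet, ∃ x ∈ GammaFull N, g ∈ rcoset GammaTheta x := by
  intro g hg
  have hg : g.det = 1 := hg
  have key : ∀ x ∈ GammaFull N, g * x.adjugate ∈ GammaTheta →
      ∃ x ∈ GammaFull N, g ∈ rcoset GammaTheta x := by
    intro x hx h
    refine ⟨x, hx, _, h, ?_⟩
    rw [mul_assoc, Matrix.adjugate_mul, hx.1, one_smul, mul_one]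
  have hN' : ¬ Even (N : ℤ) := by
    rw [Int.not_even_iff_odd]; exact_mod_cast hN
  have hT : !![1, (N : ℤ); 0, 1] ∈ GammaFull N := by simp [GammaFull, Matrix.det_fin_two]
  have hU : !![1, 0; (N : ℤ), 1] ∈ GammaFull N := by simp [GammaFull, Matrix.det_fin_two]
  have hd := hg
  rw [Matrix.det_fin_two] at hd
  have hd' := congrArg Even hd
  simp only [Int.even_mul, Int.even_sub, Int.not_even_one, eq_iff_iff] at hd'
  by_cases h1 : Even (g 0 0 * g 1 0)
  · by_cases h2 : Even (g 0 1 * g 1 1)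
    · exact key 1 (grp_full N).one (by simpa using ⟨hg, h1, h2⟩)
    · refine key _ hT ⟨?_, ?_, ?_⟩
      · rw [Matrix.det_mul, hg, Matrix.det_adjugate, hT.1]; simp
      all_goals
        simp [Matrix.adjugate_fin_two, Matrix.mul_apply, Fin.sum_univ_two]
        simp only [Int.even_mul, Int.even_add, Int.even_sub, even_neg] at *
        tauto
  · refine key _ hU ⟨?_, ?_, ?_⟩
    · rw [Matrix.det_mul, hg, Matrix.det_adjugate, hU.1]; simp
    all_goals
      simp [Matrix.adjugate_fin_two, Matrix.mul_apply, Fin.sum_univ_two]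
      simp only [Int.even_mul, Int.even_add, Int.even_sub, even_neg] at *
      tauto

theorem statement12 (N : ℕ) (hN : Odd N) (hNpos : 0 < N) :
    ((∀ x ∈ Gamma0 N, ∀ y ∈ Gamma0 N,
        (rcoset (Gamma0 N ∩ GammaTheta) x = rcoset (Gamma0 N ∩ GammaTheta) y ↔
          rcoset GammaTheta x = rcoset GammaTheta y)) ∧
      ∀ g ∈ SL2ZSet, ∃ x ∈ Gamma0 N, g ∈ rcoset GammaTheta x) ∧
    ((∀ x ∈ GammaFull N, ∀ y ∈ GammaFull N,
        (rcoset (GammaFull N ∩ GammaTheta) x = rcoset (GammaFull N ∩ GammaTheta) y ↔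
          rcoset GammaTheta x = rcoset GammaTheta y)) ∧
      ∀ g ∈ SL2ZSet, ∃ x ∈ GammaFull N, g ∈ rcoset GammaTheta x) := by
  exact ⟨⟨inj_aux (grp_0 N), fun g hg => by
    obtain ⟨x, hx, h⟩ := surj_aux N hN g hg
    exact ⟨x, full_sub N hx, h⟩⟩, inj_aux (grp_full N), surj_aux N hN⟩
end
end

section
/- Let p be an odd prime. For every s ∈ SL₂(ℤ) with s ∉ Γ₀(p), the group SL₂(ℤ) is the disjoint union of Γ₀(p) and the double coset Γ₀(p)·s·Γ₀(p); in particular SL₂(ℤ) decomposes into exactly two (Γ₀(p),Γ₀(p))-double cosets. -/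
noncomputable section

theorem statement13 (p : ℕ) (hp : Nat.Prime p) (hodd : Odd p)
    (s : Matrix (Fin 2) (Fin 2) ℤ) (hs : s.det = 1) (hsnot : s ∉ Gamma0 p) :
    (∀ g : Matrix (Fin 2) (Fin 2) ℤ, g.det = 1 →
      g ∈ Gamma0 p ∨ ∃ r₁ ∈ Gamma0 p, ∃ r₂ ∈ Gamma0 p, g = r₁ * s * r₂) ∧
    ∀ g ∈ Gamma0 p, ¬ ∃ r₁ ∈ Gamma0 p, ∃ r₂ ∈ Gamma0 p, g = r₁ * s * r₂ := by
  have hpp : Prime (p : ℤ) := Nat.prime_iff_prime_int.mp hp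
  have hsc : ¬ (p : ℤ) ∣ s 1 0 := fun h => hsnot ⟨hs, h⟩
  constructor
  · intro g hg
    by_cases hgc : (p : ℤ) ∣ g 1 0
    · exact Or.inl ⟨hg, hgc⟩
    right
    have hcc : ¬ (p : ℤ) ∣ g 1 0 * s 1 0 := fun h => (hpp.dvd_or_dvd h).elim hgc hsc
    obtain ⟨u, v, huv⟩ := (hpp.coprime_iff_not_dvd.mpr hcc)
    set t : ℤ := v * (g 1 1 * s 1 0 - g 1 0 * s 1 1) with ht
    refine ⟨g * !![1, -t; 0, 1] * s.adjugate, ⟨?_, ?_⟩, !![1, t; 0, 1], ⟨?_, ?_⟩, ?_⟩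
    · rw [Matrix.det_mul, Matrix.det_mul, Matrix.det_adjugate, hg, hs]
      simp [Matrix.det_fin_two]
    · refine ⟨-u * (g 1 1 * s 1 0 - g 1 0 * s 1 1), ?_⟩
      simp only [Matrix.adjugate_fin_two, Matrix.mul_apply, Fin.sum_univ_two]
      simp
      linear_combination (g 1 1 * s 1 0 - g 1 0 * s 1 1) * huv
    · simp [Matrix.det_fin_two]
    · simp
    · rw [Matrix.mul_assoc _ _ s, Matrix.adjugate_mul, hs, one_smul, Matrix.mul_one,
        Matrix.mul_assoc]
      have : (!![1, -t; 0, 1] * !![1, t; 0, 1] : Matrix (Fin 2) (Fin 2) ℤ) = 1 := by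
        ext i j
        fin_cases i <;> fin_cases j <;> simp [Matrix.mul_apply, Fin.sum_univ_two]
      rw [this, Matrix.mul_one]
  · rintro g ⟨-, hgc⟩ ⟨x, ⟨hx, k, hk⟩, y, ⟨hy, l, hl⟩, rfl⟩
    rw [Matrix.det_fin_two] at hx hy
    simp only [Matrix.mul_apply, Fin.sum_univ_two] at hgc
    obtain ⟨m, hm⟩ := hgc
    have h : (p : ℤ) ∣ x 1 1 * s 1 0 * y 0 0 := by
      rw [hk, hl] at hm
      exact ⟨m - k * s 0 0 * y 0 0 - (p * k * s 0 1 + x 1 1 * s 1 1) * l,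
        by linear_combination hm⟩
    rcases hpp.dvd_or_dvd h with h | ⟨n, h⟩
    · rcases hpp.dvd_or_dvd h with ⟨n, h⟩ | h
      · exact hpp.not_dvd_one ⟨x 0 0 * n - x 0 1 * k, by rw [h, hk] at hx; linear_combination -hx⟩
      · exact hsc h
    · exact hpp.not_dvd_one ⟨n * y 1 1 - y 0 1 * l, by rw [h, hl] at hy; linear_combination -hy⟩
end
end

section
/- Define the Dedekind eta function η(z) := e^{iπz/12}·Π_{n=1}^{∞}(1 − e^{2πinz}) for z in the upper half-plane ℍ. For every g = (a,b;c,d) ∈ SL₂(ℤ) and every z ∈ ℍ, η((az+b)/(cz+d))¹² = (cz+d)⁶ · sgn₂(g) · η(z)¹², where sgn₂(g) := −1 if g is not congruent to the identity modulo 2 and a+d is even, and sgn₂(g) := +1 otherwise. (Equivalently, sgn₂ is the composition of reduction modulo 2, the isomorphism SL₂(𝔽₂) ≅ S₃, and the sign character of S₃; it is the unique nontrivial character of SL₂(ℤ) that is trivial on the principal congruence subgroup Γ(2).) -/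
noncomputable section

open scoped Classical in
/-- The sign character of `SL₂(ℤ)` factoring through `SL₂(𝔽₂) ≅ S₃`. -/
def sgnTwo (g : Matrix (Fin 2) (Fin 2) ℤ) : ℂ :=
  if (¬ (Odd (g 0 0) ∧ Even (g 0 1) ∧ Even (g 1 0) ∧ Odd (g 1 1))) ∧ Even (g 0 0 + g 1 1)
  then -1 else 1

/-- The Dedekind eta function. -/
def dedekindEta (z : ℂ) : ℂ :=
  Complex.exp ((Real.pi : ℂ) * Complex.I * z / 12) *
    ∏' n : ℕ, (1 - Complex.exp (2 * (Real.pi : ℂ) * Complex.I * ((n : ℂ) + 1) * z))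

lemma dedekindEta_eq_eta (z : ℂ) : dedekindEta z = ModularForm.eta z := by
  unfold dedekindEta ModularForm.eta
  simp only [ModularForm.eta_q_eq_cexp]
  congr 1
  unfold Function.Periodic.qParam
  congr 1
  push_cast
  ring

lemma dedekindEta_T (z : ℂ) : dedekindEta (z + 1) ^ 12 = - dedekindEta z ^ 12 := by
  have hp : ∀ n : ℕ, Complex.exp (2 * (Real.pi : ℂ) * Complex.I * ((n : ℂ) + 1) * (z + 1)) =
      Complex.exp (2 * (Real.pi : ℂ) * Complex.I * ((n : ℂ) + 1) * z) := by
    intro n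
    rw [Complex.exp_eq_exp_iff_exists_int]
    exact ⟨n + 1, by push_cast; ring⟩
  unfold dedekindEta
  simp only [hp, mul_pow, ← Complex.exp_nat_mul]
  rw [show ((12 : ℕ) : ℂ) * ((Real.pi : ℂ) * Complex.I * (z + 1) / 12) =
    ((12 : ℕ) : ℂ) * ((Real.pi : ℂ) * Complex.I * z / 12) + (Real.pi : ℂ) * Complex.I by
      push_cast; ring, Complex.exp_add, Complex.exp_pi_mul_I]
  ring

lemma dedekindEta_T' (z : ℂ) : dedekindEta (z - 1) ^ 12 = - dedekindEta z ^ 12 := by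
  have := dedekindEta_T (z - 1)
  rw [sub_add_cancel] at this
  rw [this, neg_neg]

lemma sqrt_pow_twelve (z : ℂ) (hz : z ≠ 0) : Complex.sqrt z ^ 12 = z ^ 6 := by
  unfold Complex.sqrt
  rw [← Complex.cpow_nat_mul]
  norm_num

lemma dedekindEta_S (z : ℂ) (hz : 0 < z.im) :
    dedekindEta (-1 / z) ^ 12 = - z ^ 6 * dedekindEta z ^ 12 := by
  have hz0 : z ≠ 0 := by rintro rfl; simp at hz
  have h := ModularForm.eta_comp_eq_csqrt_I_inv (show z ∈ UpperHalfPlane.upperHalfPlaneSet from hz)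
  simp only [Function.comp_apply, Pi.smul_apply, Pi.mul_apply, smul_eq_mul] at h
  rw [dedekindEta_eq_eta, dedekindEta_eq_eta, h, mul_pow, mul_pow, inv_pow,
    sqrt_pow_twelve _ hz0, sqrt_pow_twelve _ Complex.I_ne_zero]
  have : Complex.I ^ 6 = -1 := by
    rw [show 6 = 2 * 3 by rfl, pow_mul, Complex.I_sq]; norm_num
  rw [this, inv_neg, inv_one]; ring

/-- Sign in terms of entries. -/
def sgE (a b c d : ℤ) : ℂ := sgnTwo !![a, b; c, d]

lemma sgE_aux (a b c d a' b' c' d' : ℤ)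
    (h : ((¬ (Odd a ∧ Even b ∧ Even c ∧ Odd d)) ∧ Even (a + d)) ↔
      ¬ ((¬ (Odd a' ∧ Even b' ∧ Even c' ∧ Odd d')) ∧ Even (a' + d'))) :
    sgE a b c d = - sgE a' b' c' d' := by
  unfold sgE sgnTwo
  simp only [Matrix.of_apply, Matrix.cons_val', Matrix.cons_val_zero, Matrix.cons_val_one,
    Matrix.cons_val_fin_one]
  by_cases h' : ((¬ (Odd a' ∧ Even b' ∧ Even c' ∧ Odd d')) ∧ Even (a' + d'))
  · rw [if_neg (by tauto), if_pos h', neg_neg]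
  · rw [if_pos (by tauto), if_neg h']

/-- The claim in terms of entries. -/
def PE (a b c d : ℤ) : Prop := ∀ z : ℂ, 0 < z.im →
  dedekindEta (((a : ℂ) * z + (b : ℂ)) / ((c : ℂ) * z + (d : ℂ))) ^ 12 =
      ((c : ℂ) * z + (d : ℂ)) ^ 6 * sgE a b c d * dedekindEta z ^ 12

lemma mob (a b c d : ℤ) (h : a * d - b * c = 1) (z : ℂ) (hz : 0 < z.im) :
    0 < (((a : ℂ) * z + (b : ℂ)) / ((c : ℂ) * z + (d : ℂ))).im ∧ (c : ℂ) * z + d ≠ 0 := by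
  let g : Matrix.SpecialLinearGroup (Fin 2) ℤ :=
    ⟨!![a, b; c, d], by rw [Matrix.det_fin_two_of]; exact h⟩
  have h1 := (g • (⟨z, hz⟩ : UpperHalfPlane)).im_pos
  rw [← UpperHalfPlane.coe_im, UpperHalfPlane.specialLinearGroup_apply] at h1
  have h2 : 0 < (((a : ℂ) * z + (b : ℂ)) / ((c : ℂ) * z + (d : ℂ))).im := by
    simpa [g] using h1
  refine ⟨h2, fun h0 => ?_⟩
  rw [h0] at h2
  simp at h2

lemma odd_det {a b c d : ℤ} (h : a * d - b * c = 1) :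
    ¬ (Even (a * d) ↔ Even (b * c)) := by
  rw [← Int.even_sub, h]; decide

lemma PE_T {a b c d : ℤ} (h : a * d - b * c = 1) (hP : PE a b c d) : PE (a + c) (b + d) c d := by
  intro z hz
  obtain ⟨h1, h2⟩ := mob a b c d h z hz
  have e : (((a + c : ℤ) : ℂ) * z + ((b + d : ℤ) : ℂ)) / ((c : ℂ) * z + (d : ℂ)) =
      ((a : ℂ) * z + (b : ℂ)) / ((c : ℂ) * z + (d : ℂ)) + 1 := by
    push_cast; field_simp; ring
  have hs : sgE (a + c) (b + d) c d = - sgE a b c d := by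
    apply sgE_aux
    have := odd_det h
    simp only [← Int.not_even_iff_odd, Int.even_add, Int.even_mul] at *
    tauto
  rw [e, dedekindEta_T, hP z hz, hs]; ring

lemma PE_T' {a b c d : ℤ} (h : a * d - b * c = 1) (hP : PE a b c d) : PE (a - c) (b - d) c d := by
  intro z hz
  obtain ⟨h1, h2⟩ := mob a b c d h z hz
  have e : (((a - c : ℤ) : ℂ) * z + ((b - d : ℤ) : ℂ)) / ((c : ℂ) * z + (d : ℂ)) =
      ((a : ℂ) * z + (b : ℂ)) / ((c : ℂ) * z + (d : ℂ)) - 1 := by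
    push_cast; field_simp; ring
  have hs : sgE (a - c) (b - d) c d = - sgE a b c d := by
    apply sgE_aux
    have := odd_det h
    simp only [← Int.not_even_iff_odd, Int.even_add, Int.even_sub, Int.even_mul] at *
    tauto
  rw [e, dedekindEta_T', hP z hz, hs]; ring

lemma PE_S {a b c d : ℤ} (h : a * d - b * c = 1) (hP : PE a b c d) : PE (-c) (-d) a b := by
  intro z hz
  obtain ⟨h1, h2⟩ := mob a b c d h z hz
  have e : (((-c : ℤ) : ℂ) * z + ((-d : ℤ) : ℂ)) / ((a : ℂ) * z + (b : ℂ)) =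
      -1 / (((a : ℂ) * z + (b : ℂ)) / ((c : ℂ) * z + (d : ℂ))) := by
    rw [div_div_eq_mul_div]; push_cast; congr 1; ring
  have hs : sgE (-c) (-d) a b = - sgE a b c d := by
    apply sgE_aux
    have := odd_det h
    simp only [← Int.not_even_iff_odd, Int.even_add, even_neg, Int.even_mul] at *
    tauto
  rw [e, dedekindEta_S _ h1, hP z hz, hs]
  generalize (c : ℂ) * z + d = w at h2
  field_simp

lemma PE_neg {a b c d : ℤ} (hP : PE a b c d) : PE (-a) (-b) (-c) (-d) := by
  intro z hz
  have e : (((-a : ℤ) : ℂ) * z + ((-b : ℤ) : ℂ)) / (((-c : ℤ) : ℂ) * z + ((-d : ℤ) : ℂ)) =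
      ((a : ℂ) * z + (b : ℂ)) / ((c : ℂ) * z + (d : ℂ)) := by
    rw [← neg_div_neg_eq]; push_cast; congr 1 <;> ring
  have hs : sgE (-a) (-b) (-c) (-d) = sgE a b c d := by
    unfold sgE sgnTwo
    simp [Int.even_add]
  rw [e, hP z hz, hs]; push_cast; ring

lemma PE_all (g : Matrix.SpecialLinearGroup (Fin 2) ℤ) :
    PE (g 0 0) (g 0 1) (g 1 0) (g 1 1) := by
  have hg : g ∈ Subgroup.closure {ModularGroup.S, ModularGroup.T} := by
    simp [SpecialLinearGroup.SL2Z_generators]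
  have hd : ∀ y : Matrix.SpecialLinearGroup (Fin 2) ℤ, y 0 0 * y 1 1 - y 0 1 * y 1 0 = 1 := by
    intro y
    have := y.det_coe
    rwa [Matrix.det_fin_two] at this
  induction hg using Subgroup.closure_induction_left with
  | one =>
    intro z hz
    simp [sgE, sgnTwo]
  | mul_left x hx y hy ih =>
    rcases hx with rfl | rfl
    · have := PE_S (hd y) ih
      convert! this using 1 <;>
        simp [ModularGroup.coe_S, Matrix.SpecialLinearGroup.coe_mul, Matrix.SpecialLinearGroup.coe_inv, Matrix.mul_apply, Fin.sum_univ_two]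
    · have := PE_T (hd y) ih
      convert! this using 1 <;>
        simp [ModularGroup.coe_T, Matrix.SpecialLinearGroup.coe_mul, Matrix.SpecialLinearGroup.coe_inv, Matrix.mul_apply, Fin.sum_univ_two]
  | inv_mul_cancel x hx y hy ih =>
    rcases hx with rfl | rfl
    · have := PE_neg (PE_S (hd y) ih)
      convert! this using 1 <;>
        simp [ModularGroup.coe_S, Matrix.SpecialLinearGroup.coe_mul, Matrix.SpecialLinearGroup.coe_inv, Matrix.mul_apply, Fin.sum_univ_two, Matrix.adjugate_fin_two]
    · have := PE_T' (hd y) ih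
      convert! this using 1 <;>
        simp [ModularGroup.coe_T, Matrix.SpecialLinearGroup.coe_mul, Matrix.SpecialLinearGroup.coe_inv, Matrix.mul_apply, Fin.sum_univ_two, Matrix.adjugate_fin_two] <;> ring

theorem statement19 (g : Matrix (Fin 2) (Fin 2) ℤ) (hdet : g.det = 1) (z : ℂ)
    (hz : 0 < z.im) :
    dedekindEta (((g 0 0 : ℂ) * z + (g 0 1 : ℂ)) / ((g 1 0 : ℂ) * z + (g 1 1 : ℂ))) ^ 12 =
      ((g 1 0 : ℂ) * z + (g 1 1 : ℂ)) ^ 6 * sgnTwo g * dedekindEta z ^ 12 := by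
  have := PE_all ⟨g, hdet⟩ z hz
  simpa only [sgE, ← Matrix.eta_fin_two g] using this
end
end
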